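/- There does not exist a triple (x, y, z) ∈ ℍ³ with ‖x‖² + ‖y‖² − ‖z‖² = 1 such that x·q·(star x) + y·q·(star y) − z·q·(star z) is real for every quaternion q with ‖q‖ = 1. -/

import Mathlib

open Matrix BigOperators

noncomputable section

abbrev Hq : Type := Quaternion ℝ

def qi : Hq := ⟨0, 1, 0, 0⟩
def qj : Hq := ⟨0, 0, 1, 0⟩
def qk : Hq := ⟨0, 0, 0, 1⟩

/-- A quaternion is real if all its imaginary parts vanish. -/
def isRealQ (q : Hq) : Prop := q.imI = 0 ∧ q.imJ = 0 ∧ q.imK = 0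

/-- The matrix `J_{n,1}` with diagonal `(1,…,1,−1)`. -/
def Jq (n : ℕ) : Matrix (Fin (n+1)) (Fin (n+1)) Hq :=
  Matrix.diagonal fun i => if i = Fin.last n then -1 else 1

/-- `Sp(n,1)` as a set of `(n+1)×(n+1)` quaternionic matrices. -/
def Sp (n : ℕ) : Set (Matrix (Fin (n+1)) (Fin (n+1)) Hq) :=
  {g | gᴴ * Jq n * g = Jq n}

/-- The complex matrix `J_{m,1}`. -/
def Jc (m : ℕ) : Matrix (Fin (m+1)) (Fin (m+1)) ℂ :=
  Matrix.diagonal fun i => if i = Fin.last m then -1 else 1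

/-- `SU(m,1)` as a set of `(m+1)×(m+1)` complex matrices. -/
def SU (m : ℕ) : Set (Matrix (Fin (m+1)) (Fin (m+1)) ℂ) :=
  {A | Aᴴ * Jc m * A = Jc m ∧ A.det = 1}

/-- The ℝ-algebra embedding `ℂ → ℍ`, `a + b√(−1) ↦ a + b i`. -/
def ι (z : ℂ) : Hq := ⟨z.re, z.im, 0, 0⟩


/-- Every quaternion commutes with some purely imaginary unit quaternion. -/
lemma exists_unit_imaginary_commute (w : Hq) :
    ∃ q : Hq, ‖q‖ = 1 ∧ star q = -q ∧ Commute w q := by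
  by_cases hw : w.im = 0
  · refine ⟨qi, ?_, ?_, ?_⟩
    · rw [← sq_eq_sq₀ (norm_nonneg _) zero_le_one, sq, ← Quaternion.normSq_eq_norm_mul_self]
      rw [Quaternion.normSq_def']
      norm_num [qi]
    · exact Quaternion.star_eq_neg.mpr rfl
    · rw [← Quaternion.re_add_im w, hw, add_zero]
      exact Quaternion.coe_commutes _ _
  · refine ⟨‖w.im‖⁻¹ • w.im, ?_, ?_, ?_⟩
    · exact norm_smul_inv_norm hw
    · ext <;> simp
    · refine Commute.smul_right ?_ _
      have h : Commute (w.re + w.im : Hq) w.im :=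
        Commute.add_left (Quaternion.coe_commutes w.re w.im) (Commute.refl _)
      rwa [Quaternion.re_add_im] at h

lemma eq_zero_of_isRealQ_of_star_eq_neg {q : Hq} (h : isRealQ q) (hq : star q = -q) :
    q = 0 := by
  obtain ⟨hi, hj, hk⟩ := h
  exact Quaternion.ext _ _ (Quaternion.star_eq_neg.mp hq) hi hj hk

/-- there is no triple `(x,y,z) ∈ ℍ³` with `‖x‖²+‖y‖²−‖z‖² = 1` such that
`x q x̄ + y q ȳ − z q z̄` is real for every unit quaternion `q`. -/
theorem stmt5 :
    ¬ ∃ x y z : Hq, ‖x‖ ^ 2 + ‖y‖ ^ 2 - ‖z‖ ^ 2 = 1 ∧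
      ∀ q : Hq, ‖q‖ = 1 → isRealQ (x * q * star x + y * q * star y - z * q * star z) := by
  rintro ⟨x, y, z, hn, h⟩
  obtain ⟨q, hq, hqs, hc⟩ := exists_unit_imaginary_commute (star y * x)
  have hsum : x * q * star x + y * q * star y = z * q * star z :=
    sub_eq_zero.mp <| eq_zero_of_isRealQ_of_star_eq_neg (h q hq) <| by
      simp only [star_sub, star_add, star_mul, star_star, hqs]
      noncomm_ring
  have hnorm (u : Hq) : ‖u * q * star u‖ = ‖u‖ ^ 2 := by
    rw [norm_mul, norm_mul, hq, norm_star]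
    ring
  have hself (u : Hq) : u * star u = ((‖u‖ ^ 2 : ℝ) : Hq) := by
    rw [Quaternion.self_mul_star, Quaternion.normSq_eq_norm_mul_self, sq]
  -- The conjugates of `q` by `x` and `y` are positively proportional.
  have hprop : ‖y‖ ^ 2 • (x * q * star x) = ‖x‖ ^ 2 • (y * q * star y) := by
    rw [← Quaternion.coe_mul_eq_smul, ← Quaternion.mul_coe_eq_smul, ← hself, ← hself]
    calc y * star y * (x * q * star x) = y * (star y * x * q) * star x := by
          simp only [mul_assoc]
      _ = y * q * star y * (x * star x) := by
          rw [hc.eq]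
          simp only [mul_assoc]
  rcases eq_or_ne x 0 with rfl | hx
  · have hyz := congrArg norm hsum
    rw [zero_mul, zero_mul, zero_add, hnorm, hnorm] at hyz
    simp only [norm_zero] at hn
    linarith
  · have hscaled : (‖x‖ ^ 2 + ‖y‖ ^ 2) • (x * q * star x) = ‖x‖ ^ 2 • (z * q * star z) := by
      rw [← hsum, smul_add, ← hprop, add_smul]
    have hz := congrArg norm hscaled
    rw [norm_smul, norm_smul, hnorm, hnorm, Real.norm_of_nonneg (by positivity),
      Real.norm_of_nonneg (by positivity), mul_comm] at hz
    have := mul_left_cancel₀ (pow_ne_zero 2 (norm_ne_zero_iff.mpr hx)) hz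
    linarith
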